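/- Let b be a prime and m, n ∈ ℕ with n > 2m. Let P_H^{sym,n} be the truncated symmetrized Hammersley point set in base b, i.e., the two-dimensional digital net over ℤ_b with N = b^{m+2} points generated by the matrices C₁, C₂ ∈ ℤ_b^{n×(m+2)} with (C₁)_{l,j} = 1 iff (j = l and l ≤ m) or j = m+1, and (C₂)_{l,j} = 1 iff (j = m+1−l and l ≤ m) or j = m+2. Then the minimum Dick weight satisfies ρ₂(P_H^{sym,n}) > 2m+1; consequently, for every p ∈ [1,∞) there exists a constant C_p > 0, independent of m and n, such that L_p(P_H^{sym,n}) ≤ C_p · √(m+2) / b^{m+2} = C_p · √(log_b N) / N. -/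

import Mathlib

open MeasureTheory

noncomputable section

namespace Sym

/-! ### The group `G = (ℤ_b)^ℕ` and its normalized Haar (= product) measure -/

instance (b : ℕ) : TopologicalSpace (ZMod b) := ⊥
instance (b : ℕ) : DiscreteTopology (ZMod b) := ⟨rfl⟩
instance (b : ℕ) : MeasurableSpace (ZMod b) := ⊤
instance (b : ℕ) : BorelSpace (ZMod b) :=
  ⟨(borel_eq_top_of_discrete (α := ZMod b)).symm⟩

/-- `G = (ℤ_b)^ℕ`, the compact totally disconnected abelian group of `ℤ_b`-valued
sequences with componentwise addition modulo `b`. -/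
abbrev G (b : ℕ) := ℕ → ZMod b

/-- The product measure `ν` on `G`, realized as the normalized Haar measure of the
compact group `G` (which is the product of the uniform probability measures on `ℤ_b`). -/
def nu (b : ℕ) [NeZero b] : Measure (G b) :=
  Measure.addHaarMeasure (⊤ : TopologicalSpace.PositiveCompacts (G b))

/-- The product measure on `G^s`. -/
def nuS (b : ℕ) [NeZero b] (s : ℕ) : Measure (Fin s → G b) :=
  Measure.pi fun _ : Fin s => nu b

/-! ### b-adic digits, characters, projection, section, Walsh functions -/

/-- the `i`-th `b`-adic digit of `k` (`i = 0,1,2,...`). -/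
def dgt (b k i : ℕ) : ℕ := k / b ^ i % b

/-- the `i`-th `b`-adic digit of `k`, as an element of `ℤ_b`. -/
def zdgt (b k i : ℕ) : ZMod b := (dgt b k i : ZMod b)

/-- the `b`-adic digit sum `δ(k)` of `k`. -/
def dsum (b k : ℕ) : ℕ := ∑ i ∈ Finset.range k, dgt b k i

/-- `k ∈ 𝓔`, i.e. the `b`-adic digit sum of `k` is `≡ 0 (mod b)`. -/
def inE (b k : ℕ) : Prop := dsum b k % b = 0

/-- The `k`-th character `W_k : G → ℂ`,
`W_k(z) = ω^(κ₀ζ₁ + ⋯ + κ_{a-1}ζ_a)` with `ω = exp(2π√-1/b)`. -/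
def W (b k : ℕ) (z : G b) : ℂ :=
  Complex.exp (2 * Real.pi * Complex.I *
    (∑ i ∈ Finset.range k, (dgt b k i : ℝ) * ((z i).val : ℝ)) / b)

/-- The `k`-th character on `G^s`. -/
def WS (b s : ℕ) (k : Fin s → ℕ) (z : Fin s → G b) : ℂ :=
  ∏ j, W b (k j) (z j)

/-- The projection `π : G → [0,1]`, `π(z) = ∑_{i≥1} ζ_i b^{-i}`. -/
def projG (b : ℕ) (z : G b) : ℝ := ∑' i : ℕ, ((z i).val : ℝ) / b ^ (i + 1)

/-- The componentwise projection `π : G^s → [0,1]^s`. -/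
def projS (b s : ℕ) (z : Fin s → G b) : Fin s → ℝ := fun j => projG b (z j)

/-- The section `σ : [0,1] → G`, sending `x` to the digits of its unique `b`-adic
expansion with infinitely many digits `≠ b-1` (all digits `b-1` for `x = 1`). -/
def secG (b : ℕ) (x : ℝ) : G b := fun i =>
  if x = 1 then (-1 : ZMod b) else ((⌊x * (b : ℝ) ^ (i + 1)⌋ : ℤ) : ZMod b)

/-- The componentwise section `σ : [0,1]^s → G^s`. -/
def secS (b s : ℕ) (x : Fin s → ℝ) : Fin s → G b := fun j => secG b (x j)

/-- The unit cube `[0,1]^s`. -/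
def cube (s : ℕ) : Set (Fin s → ℝ) := Set.Icc 0 1

/-- The `k`-th `b`-adic Walsh function on `[0,1]^s`, `wal_k(x) = W_k(σ(x))`. -/
def walS (b s : ℕ) (k : Fin s → ℕ) (x : Fin s → ℝ) : ℂ := WS b s k (secS b s x)

/-- The `(k,l)`-th Walsh coefficient of a kernel `K`. -/
def Khat (b s : ℕ) (K : (Fin s → ℝ) → (Fin s → ℝ) → ℝ) (k l : Fin s → ℕ) : ℂ :=
  ∫ x in cube s, ∫ y in cube s,
    (K x y : ℂ) * (starRingEnd ℂ) (walS b s k x) * walS b s l y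

/-! ### Digital nets -/

/-- The point `z_n` of the digital net with generating matrices `C₁,…,C_s ∈ ℤ_b^{ℕ×m}`:
its `j`-th component is `(ν₀,…,ν_{m-1})·C_j^⊤ ∈ G` where `n = ∑ ν_i b^i`. -/
def netPt (b m s : ℕ) (C : Fin s → ℕ → Fin m → ZMod b) (n : ℕ) : Fin s → G b :=
  fun j i => ∑ t : Fin m, zdgt b n t * C j i t

/-- The digital net over `ℤ_b` in `G^s` with generating matrices `C₁,…,C_s`, as a
multiset (points counted with multiplicity). -/
def netMS (b m s : ℕ) (C : Fin s → ℕ → Fin m → ZMod b) : Multiset (Fin s → G b) :=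
  (Multiset.range (b ^ m)).map (netPt b m s C)

/-- membership in the dual net: `k⃗₁C₁ ⊕ ⋯ ⊕ k⃗_sC_s = 0 ∈ ℤ_b^m`. -/
def inDual (b m s : ℕ) (C : Fin s → ℕ → Fin m → ZMod b) (k : Fin s → ℕ) : Prop :=
  ∀ t : Fin m, ∑ j, ∑ i ∈ Finset.range (k j), zdgt b (k j) i * C j i t = 0

/-- `e_l = (e_{l₁},…,e_{l_s}) ∈ G^s` where `e_{l_j} = (l_j, l_j, …) ∈ G`. -/
def ept (b s : ℕ) (l : Fin s → ZMod b) : Fin s → G b := fun j _ => l j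

/-- The symmetrized point set `𝒫^sym = {z ⊕ e_l : z ∈ 𝒫, l ∈ ℤ_b^s}` of a multiset
`𝒫 ⊂ G^s`. -/
def symMS (b s : ℕ) [NeZero b] (P : Multiset (Fin s → G b)) : Multiset (Fin s → G b) :=
  P.bind fun z => (Finset.univ : Finset (Fin s → ZMod b)).val.map fun l => z + ept b s l

/-- The generating matrices `D_j = (C_j, E_j)` of the symmetrized digital net, where the
`j`-th column of `E_j ∈ ℤ_b^{ℕ×s}` is all ones and its other entries vanish. -/
def symMat (b m s : ℕ) (C : Fin s → ℕ → Fin m → ZMod b) (j : Fin s) (i : ℕ)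
    (t : Fin (m + s)) : ZMod b :=
  if h : (t : ℕ) < m then C j i ⟨t, h⟩ else if (t : ℕ) = m + j then 1 else 0

/-- The symmetrized digital net `π(𝒫^sym) ⊂ [0,1]^s` of the digital net with generating
matrices `C₁,…,C_s`, as a multiset of points of `[0,1]^s`. -/
def symNetPts (b m s : ℕ) [NeZero b] (C : Fin s → ℕ → Fin m → ZMod b) :
    Multiset (Fin s → ℝ) :=
  (symMS b s (netMS b m s C)).map (projS b s)

/-! ### Worst-case error, digital shift -/

/-- The squared worst-case error
`e²(P,K) = ∫∫K − (2/|P|) ∑_{x∈P} ∫ K(x,y)dy + (1/|P|²) ∑_{x,y∈P} K(x,y)`. -/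
def sqErr (s : ℕ) (P : Multiset (Fin s → ℝ)) (K : (Fin s → ℝ) → (Fin s → ℝ) → ℝ) : ℝ :=
  (∫ x in cube s, ∫ y in cube s, K x y)
    - 2 / (P.card : ℝ) * (P.map fun x => ∫ y in cube s, K x y).sum
    + 1 / (P.card : ℝ) ^ 2 * (P.map fun x => (P.map fun y => K x y).sum).sum

/-- The `b`-adic digital shift `x ⊕ y := π(σ(x) ⊕ σ(y))` on `[0,1]^s`. -/
def dshiftS (b s : ℕ) (x y : Fin s → ℝ) : Fin s → ℝ :=
  fun j => projG b (secG b (x j) + secG b (y j))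

/-- The digital shift invariant kernel `K_ds(x,y) = ∫_{[0,1]^s} K(x⊕σ̃, y⊕σ̃) dσ̃`. -/
def Kds (b s : ℕ) (K : (Fin s → ℝ) → (Fin s → ℝ) → ℝ) (x y : Fin s → ℝ) : ℝ :=
  ∫ t in cube s, K (dshiftS b s x t) (dshiftS b s y t)

/-! ### Two-dimensional discrepancy and the Dick weight -/

/-- The local discrepancy `Δ(t;P)` of a finite multiset `P ⊂ [0,1]²`. -/
def disc2 (P : Multiset (ℝ × ℝ)) (t : ℝ × ℝ) : ℝ :=
  (P.map fun x => if 0 ≤ x.1 ∧ x.1 < t.1 ∧ 0 ≤ x.2 ∧ x.2 < t.2 then (1 : ℝ) else 0).sum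
      / (P.card : ℝ)
    - t.1 * t.2

/-- The `L_p` discrepancy of a finite multiset `P ⊂ [0,1]²`. -/
def LpDisc (p : ℝ) (P : Multiset (ℝ × ℝ)) : ℝ :=
  (∫ t in Set.Icc ((0 : ℝ), (0 : ℝ)) (1, 1), |disc2 P t| ^ p) ^ (1 / p)

/-- The Dick weight `μ₂(k) = a₁ + a₂` (resp. `a₁`, `0`), where `a₁ > a₂` are the positions
of the two highest nonzero `b`-adic digits of `k`. -/
def mu2 (b k : ℕ) : ℕ :=
  if k = 0 then 0
  else Nat.log b k + 1 +
    (if k % b ^ Nat.log b k = 0 then 0 else Nat.log b (k % b ^ Nat.log b k) + 1)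

end Sym

open MeasureTheory Sym

open scoped Classical

noncomputable section

namespace Sym

/-- The two-dimensional symmetrized Hammersley point set in base `b` with `b^{m+2}`
points `(x_a, y_a)`, `a = (a₁,…,a_{m+2}) ∈ {0,…,b-1}^{m+2}`. -/
def hamSymPts (b m : ℕ) [NeZero b] : Multiset (ℝ × ℝ) :=
  (Finset.univ : Finset (Fin (m + 2) → ZMod b)).val.map fun a =>
    (∑ i : Fin m,
        ((a (Fin.castLE (by omega) i) + a ⟨m, by omega⟩).val : ℝ) / (b : ℝ) ^ ((i : ℕ) + 1)
       + ((a ⟨m, by omega⟩).val : ℝ) / ((b : ℝ) ^ m * ((b : ℝ) - 1)),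
     ∑ i : Fin m,
        ((a ⟨m - 1 - (i : ℕ), by omega⟩ + a ⟨m + 1, by omega⟩).val : ℝ) / (b : ℝ) ^ ((i : ℕ) + 1)
       + ((a ⟨m + 1, by omega⟩).val : ℝ) / ((b : ℝ) ^ m * ((b : ℝ) - 1)))

/-- The truncated two-dimensional symmetrized Hammersley point set `P_H^{sym,n}`. -/
def hamSymPtsTrunc (b m n : ℕ) [NeZero b] : Multiset (ℝ × ℝ) :=
  (Finset.univ : Finset (Fin (m + 2) → ZMod b)).val.map fun a =>
    (∑ i : Fin m,
        ((a (Fin.castLE (by omega) i) + a ⟨m, by omega⟩).val : ℝ) / (b : ℝ) ^ ((i : ℕ) + 1)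
       + ∑ i ∈ Finset.Icc (m + 1) n, ((a ⟨m, by omega⟩).val : ℝ) / (b : ℝ) ^ i,
     ∑ i : Fin m,
        ((a ⟨m - 1 - (i : ℕ), by omega⟩ + a ⟨m + 1, by omega⟩).val : ℝ) / (b : ℝ) ^ ((i : ℕ) + 1)
       + ∑ i ∈ Finset.Icc (m + 1) n, ((a ⟨m + 1, by omega⟩).val : ℝ) / (b : ℝ) ^ i)

/-- The two-dimensional digital net (in `[0,1]²`) with generating matrices
`C₁, C₂ ∈ ℤ_b^{ℕ×m}`. -/
def netPts2 (b m : ℕ) (C₁ C₂ : ℕ → Fin m → ZMod b) : Multiset (ℝ × ℝ) :=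
  (Multiset.range (b ^ m)).map fun n =>
    (projG b (netPt b m 2 ![C₁, C₂] n 0), projG b (netPt b m 2 ![C₁, C₂] n 1))

/-- `l`-th row (`l` 1-based) of the first generating matrix `C₁` of the truncated
symmetrized Hammersley point set: `(C₁)_{l,j} = 1` iff (`j = l` and `l ≤ m`) or `j = m+1`. -/
def hamRow1 (b m : ℕ) (l : ℕ) : Fin (m + 2) → ZMod b := fun j =>
  if ((j : ℕ) + 1 = l ∧ l ≤ m) ∨ (j : ℕ) + 1 = m + 1 then 1 else 0

/-- `l`-th row (`l` 1-based) of the second generating matrix `C₂`: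
`(C₂)_{l,j} = 1` iff (`j = m+1-l` and `l ≤ m`) or `j = m+2`. -/
def hamRow2 (b m : ℕ) (l : ℕ) : Fin (m + 2) → ZMod b := fun j =>
  if ((j : ℕ) + 1 = m + 1 - l ∧ l ≤ m) ∨ (j : ℕ) + 1 = m + 2 then 1 else 0

/-- row selector for the two matrices. -/
def hamRow (b m : ℕ) : Fin 2 → ℕ → Fin (m + 2) → ZMod b := ![hamRow1 b m, hamRow2 b m]

/-- The truncated symmetrized Hammersley point set, given as the two-dimensional digital
net with the `n × (m+2)` generating matrices `C₁, C₂` above. -/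
def truncHamPts (b m n : ℕ) : Multiset (ℝ × ℝ) :=
  (Multiset.range (b ^ (m + 2))).map fun u =>
    (∑ i ∈ Finset.range n,
        ((∑ t : Fin (m + 2), zdgt b u (t : ℕ) * hamRow1 b m (i + 1) t).val : ℝ)
          / (b : ℝ) ^ (i + 1),
     ∑ i ∈ Finset.range n,
        ((∑ t : Fin (m + 2), zdgt b u (t : ℕ) * hamRow2 b m (i + 1) t).val : ℝ)
          / (b : ℝ) ^ (i + 1))

end Sym

namespace Sym

lemma dgt_ne_zero_iff_zdgt_ne_zero {b : ℕ} (hb : 2 ≤ b) (k i : ℕ) :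
    dgt b k i ≠ 0 ↔ zdgt b k i ≠ 0 := by
  unfold zdgt
  rw [Ne, Ne, ZMod.natCast_eq_zero_iff]
  refine not_congr ⟨fun h => h ▸ dvd_zero b, fun h => ?_⟩
  exact Nat.eq_zero_of_dvd_of_lt h (Nat.mod_lt _ (by omega))

lemma pow_le_of_dgt_ne_zero {b k i : ℕ} (h : dgt b k i ≠ 0) : b ^ i ≤ k := by
  by_contra hlt
  exact h (by simp [dgt, Nat.div_eq_of_lt (not_le.mp hlt)])

lemma dgt_log_ne_zero {b k : ℕ} (hb : 2 ≤ b) (hk : k ≠ 0) : dgt b k (Nat.log b k) ≠ 0 := by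
  have h1 : b ^ Nat.log b k ≤ k := Nat.pow_log_le_self b hk
  have h2 : k < b ^ (Nat.log b k + 1) := Nat.lt_pow_succ_log_self hb k
  have h3 : k / b ^ Nat.log b k < b := by
    apply Nat.div_lt_of_lt_mul
    rwa [← pow_succ]
  have h4 : 0 < k / b ^ Nat.log b k := Nat.div_pos h1 (by positivity)
  unfold dgt
  rw [Nat.mod_eq_of_lt h3]
  omega

lemma succ_le_mu2 {b k i : ℕ} (hb : 2 ≤ b) (h : dgt b k i ≠ 0) : i + 1 ≤ mu2 b k := by
  have hle := pow_le_of_dgt_ne_zero h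
  have hk : k ≠ 0 := by
    have : 0 < b ^ i := by positivity
    omega
  have := Nat.le_log_of_pow_le hb hle
  unfold mu2
  rw [if_neg hk]
  omega

lemma add_add_two_le_mu2 {b k i j : ℕ} (hb : 2 ≤ b) (hij : i < j) (hi : dgt b k i ≠ 0)
    (hj : dgt b k j ≠ 0) : i + j + 2 ≤ mu2 b k := by
  have hle := pow_le_of_dgt_ne_zero hj
  have hk : k ≠ 0 := by
    have : 0 < b ^ j := by positivity
    omega
  have hjL := Nat.le_log_of_pow_le hb hle
  have hdgt : dgt b (k % b ^ Nat.log b k) i = dgt b k i := by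
    unfold dgt
    rw [← Nat.mod_mul_right_div_self, ← Nat.mod_mul_right_div_self, ← pow_succ,
      Nat.mod_mod_of_dvd _ (pow_dvd_pow b (by omega))]
  have hle' : b ^ i ≤ k % b ^ Nat.log b k := pow_le_of_dgt_ne_zero (hdgt ▸ hi)
  have hr : k % b ^ Nat.log b k ≠ 0 := by
    have : 0 < b ^ i := by positivity
    omega
  have := Nat.le_log_of_pow_le hb hle'
  unfold mu2
  rw [if_neg hk, if_neg hr]
  omega

lemma add_add_two_le_mu2_of_ne {b k i j : ℕ} (hb : 2 ≤ b) (hij : i ≠ j) (hi : dgt b k i ≠ 0)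
    (hj : dgt b k j ≠ 0) : i + j + 2 ≤ mu2 b k := by
  rcases lt_or_gt_of_ne hij with h | h
  · exact add_add_two_le_mu2 hb h hi hj
  · have := add_add_two_le_mu2 hb h hj hi
    omega

lemma hamRow1_apply (b m i t : ℕ) (ht : t < m + 2) :
    hamRow1 b m (i + 1) ⟨t, ht⟩
      = (if t = i then if i < m then 1 else 0 else 0) + if t = m then 1 else 0 := by
  unfold hamRow1
  by_cases h1 : t = i <;> by_cases h2 : i < m <;> by_cases h3 : t = m <;>
    simp [h1, h2, h3] <;> omega

lemma hamRow2_apply (b m i t : ℕ) (ht : t < m + 2) :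
    hamRow2 b m (i + 1) ⟨t, ht⟩
      = (if t = m - 1 - i then if i < m then 1 else 0 else 0) + if t = m + 1 then 1 else 0 := by
  unfold hamRow2
  have h0 : (t + 1 = m + 1 - (i + 1) ∧ i + 1 ≤ m) ↔ (t = m - 1 - i ∧ i < m) := by omega
  simp only [h0]
  by_cases h2 : i < m
  · by_cases h1 : t = m - 1 - i <;> by_cases h3 : t = m + 1 <;> simp [h1, h2, h3] <;> omega
  · by_cases h3 : t = m + 1 <;> simp [h2, h3]

lemma sum_mul_hamRow1 (b m i : ℕ) (f : ℕ → ZMod b) :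
    ∑ t : Fin (m + 2), f t * hamRow1 b m (i + 1) t = (if i < m then f i else 0) + f m := by
  let g : ℕ → ZMod b := fun t =>
    f t * ((if t = i then if i < m then 1 else 0 else 0) + if t = m then 1 else 0)
  have h : ∀ t : Fin (m + 2), f t * hamRow1 b m (i + 1) t = g t := fun t =>
    congrArg (f t * ·) (hamRow1_apply b m i t t.2)
  rw [Finset.sum_congr rfl fun t _ => h t, Fin.sum_univ_eq_sum_range g]
  simp only [g, mul_add, Finset.sum_add_distrib, mul_ite, mul_zero, mul_one, Finset.sum_ite_eq',
    Finset.mem_range]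
  rw [if_pos (by omega : m < m + 2)]
  by_cases h : i < m
  · simp [h, show i < m + 2 by omega]
  · simp [h]

lemma sum_mul_hamRow2 (b m i : ℕ) (f : ℕ → ZMod b) :
    ∑ t : Fin (m + 2), f t * hamRow2 b m (i + 1) t
      = (if i < m then f (m - 1 - i) else 0) + f (m + 1) := by
  let g : ℕ → ZMod b := fun t =>
    f t * ((if t = m - 1 - i then if i < m then 1 else 0 else 0) + if t = m + 1 then 1 else 0)
  have h : ∀ t : Fin (m + 2), f t * hamRow2 b m (i + 1) t = g t := fun t =>
    congrArg (f t * ·) (hamRow2_apply b m i t t.2)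
  rw [Finset.sum_congr rfl fun t _ => h t, Fin.sum_univ_eq_sum_range g]
  simp only [g, mul_add, Finset.sum_add_distrib, mul_ite, mul_zero, mul_one, Finset.sum_ite_eq',
    Finset.mem_range]
  rw [if_pos (by omega : m + 1 < m + 2), if_pos (by omega : m - 1 - i < m + 2)]

lemma exists_ne_of_sum_eq_zero {b n j : ℕ} {f : ℕ → ZMod b} (hj : j < n) (hfj : f j ≠ 0)
    (hsum : ∑ i ∈ Finset.range n, f i = 0) : ∃ i < n, i ≠ j ∧ f i ≠ 0 := by
  by_contra! h
  refine hfj ?_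
  rw [← hsum, Finset.sum_eq_single j (fun i hi hij => h i (Finset.mem_range.mp hi) hij)]
  exact fun hj' => absurd (Finset.mem_range.mpr hj) hj'

/-- The minimum Dick weight of the truncated symmetrized Hammersley point set. -/
lemma two_mul_add_one_lt_mu2_add_mu2 {b m n k₁ k₂ : ℕ} (hb : 2 ≤ b) (hn : 2 * m < n)
    (hdual : ∀ t : Fin (m + 2),
      (∑ i ∈ Finset.range n, zdgt b k₁ i * hamRow1 b m (i + 1) t)
        + ∑ i ∈ Finset.range n, zdgt b k₂ i * hamRow2 b m (i + 1) t = 0)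
    (hk : ¬(k₁ = 0 ∧ k₂ = 0)) : 2 * m + 1 < mu2 b k₁ + mu2 b k₂ := by
  have hz := dgt_ne_zero_iff_zdgt_ne_zero hb
  have hlow : ∀ t < m, zdgt b k₁ t + zdgt b k₂ (m - 1 - t) = 0 := by
    intro t ht
    have h := hdual ⟨t, by omega⟩
    simp only [hamRow1_apply, hamRow2_apply, if_neg ht.ne, if_neg (by omega : t ≠ m + 1),
      add_zero] at h
    rw [Finset.sum_eq_single t, Finset.sum_eq_single (m - 1 - t)] at h
    · rwa [if_pos rfl, if_pos ht, if_pos (by omega), if_pos (by omega), mul_one, mul_one] at h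
    · intro i _ hi
      by_cases him : i < m
      · rw [if_neg (by omega), mul_zero]
      · simp [him]
    · intro h'
      exact absurd (Finset.mem_range.mpr (by omega)) h'
    · intro i _ hi
      rw [if_neg hi.symm, mul_zero]
    · intro h'
      exact absurd (Finset.mem_range.mpr (by omega)) h'
  have hsum₁ : ∑ i ∈ Finset.range n, zdgt b k₁ i = 0 := by
    have h := hdual ⟨m, by omega⟩
    simp only [hamRow1_apply, hamRow2_apply] at h
    rw [← h, Finset.sum_eq_zero (s := Finset.range n) (f := fun i => zdgt b k₂ i * _), add_zero]
    · refine Finset.sum_congr rfl fun i _ => ?_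
      by_cases him : m = i <;> simp [him]
    · intro i _
      by_cases him : i < m
      · rw [if_neg (by omega)]
        simp
      · simp [him]
  have hsum₂ : ∑ i ∈ Finset.range n, zdgt b k₂ i = 0 := by
    have h := hdual ⟨m + 1, by omega⟩
    simp only [hamRow1_apply, hamRow2_apply] at h
    rw [← h, Finset.sum_eq_zero (s := Finset.range n) (f := fun i => zdgt b k₁ i * _), zero_add]
    · refine Finset.sum_congr rfl fun i _ => ?_
      rw [if_neg (by omega)]
      simp
    · intro i _
      by_cases him : i < m
      · rw [if_neg (by omega)]
        simp
      · simp [him]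
  by_cases hk₁ : k₁ = 0
  · have hk₂ : k₂ ≠ 0 := fun h => hk ⟨hk₁, h⟩
    have hj := dgt_log_ne_zero hb hk₂
    set j := Nat.log b k₂
    have hhigh : ∀ i, zdgt b k₂ i ≠ 0 → m ≤ i := by
      intro i hi
      by_contra him
      have h := hlow (m - 1 - i) (by omega)
      rw [show m - 1 - (m - 1 - i) = i by omega, hk₁] at h
      exact hi (by simpa [zdgt, dgt] using h)
    by_cases hjn : j < n
    · obtain ⟨i, -, hij, hi⟩ := exists_ne_of_sum_eq_zero hjn ((hz _ _).mp hj) hsum₂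
      have := add_add_two_le_mu2_of_ne hb hij ((hz _ _).mpr hi) hj
      have := hhigh i hi
      have := hhigh j ((hz _ _).mp hj)
      omega
    · have := succ_le_mu2 hb hj
      omega
  · have hj := dgt_log_ne_zero hb hk₁
    set j := Nat.log b k₁
    by_cases hjn : j < n
    · obtain ⟨i, -, hij, hi⟩ := exists_ne_of_sum_eq_zero hjn ((hz _ _).mp hj) hsum₁
      have h1 := add_add_two_le_mu2_of_ne hb hij ((hz _ _).mpr hi) hj
      have hrefl : ∀ t < m, zdgt b k₁ t ≠ 0 → dgt b k₂ (m - 1 - t) ≠ 0 := by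
        intro t ht h
        rw [hz]
        intro h'
        have := hlow t ht
        rw [h', add_zero] at this
        exact h this
      by_cases him : i < m <;> by_cases hjm : j < m
      · have := add_add_two_le_mu2_of_ne hb (by omega) (hrefl i him hi)
          (hrefl j hjm ((hz _ _).mp hj))
        omega
      · have := succ_le_mu2 hb (hrefl i him hi)
        omega
      · have := succ_le_mu2 hb (hrefl j hjm ((hz _ _).mp hj))
        omega
      · omega
    · have := succ_le_mu2 hb hj
      omega

end Sym

namespace Sym

lemma disc2_truncHamPts (b m n : ℕ) (t : ℝ × ℝ) :
    disc2 (truncHamPts b m n) t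
      = (∑ u ∈ Finset.range (b ^ (m + 2)),
          if ∑ i ∈ Finset.range n, ((∑ t : Fin (m + 2), zdgt b u (t : ℕ)
              * hamRow1 b m (i + 1) t).val : ℝ) / (b : ℝ) ^ (i + 1) < t.1 ∧
            ∑ i ∈ Finset.range n, ((∑ t : Fin (m + 2), zdgt b u (t : ℕ)
              * hamRow2 b m (i + 1) t).val : ℝ) / (b : ℝ) ^ (i + 1) < t.2
          then (1 : ℝ) else 0) / (b : ℝ) ^ (m + 2) - t.1 * t.2 := by
  unfold disc2 truncHamPts
  rw [Multiset.map_map, Multiset.card_map, Multiset.card_range, Nat.cast_pow]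
  have hsum : ∀ (N : ℕ) (f : ℕ → ℝ),
      ((Multiset.range N).map f).sum = ∑ u ∈ Finset.range N, f u := fun _ _ => rfl
  rw [hsum]
  congr 2
  refine Finset.sum_congr rfl fun u _ => ?_
  refine if_congr ⟨fun h => ⟨h.2.1, h.2.2.2⟩, fun h => ⟨?_, h.1, ?_, h.2⟩⟩ rfl rfl <;>
    dsimp only <;> exact Finset.sum_nonneg fun i _ => by positivity

/-! ### Sums over residues and over base `b` digits -/

lemma sum_range_mul_eq {R : Type*} [AddCommMonoid R] (M N : ℕ) (f : ℕ → R) :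
    ∑ x ∈ Finset.range (M * N), f x
      = ∑ x ∈ Finset.range M, ∑ e ∈ Finset.range N, f (x * N + e) := by
  induction M with
  | zero => simp
  | succ M ih => rw [add_mul, one_mul, Finset.sum_range_add, ih, Finset.sum_range_succ]

section ZModSums

variable {b : ℕ} [NeZero b]

lemma sum_zmod_val {R : Type*} [AddCommMonoid R] (f : ℕ → R) :
    ∑ e : ZMod b, f e.val = ∑ e ∈ Finset.range b, f e := by
  obtain _ | n := b
  · exact absurd rfl (NeZero.ne 0)
  · exact (Finset.sum_range f).symm

lemma sum_range_pow_succ_low {R : Type*} [AddCommMonoid R] (m : ℕ) (f : ℕ → R) :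
    ∑ x ∈ Finset.range (b ^ (m + 1)), f x
      = ∑ x ∈ Finset.range (b ^ m), ∑ e : ZMod b, f (x * b + e.val) := by
  rw [pow_succ, sum_range_mul_eq]
  exact Finset.sum_congr rfl fun x _ => (sum_zmod_val fun e => f (x * b + e)).symm

lemma sum_range_pow_succ_high {R : Type*} [AddCommMonoid R] (m : ℕ) (f : ℕ → R) :
    ∑ x ∈ Finset.range (b ^ (m + 1)), f x
      = ∑ e : ZMod b, ∑ x ∈ Finset.range (b ^ m), f (e.val * b ^ m + x) := by
  rw [pow_succ', sum_range_mul_eq]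
  exact (sum_zmod_val fun e => ∑ x ∈ Finset.range (b ^ m), f (e * b ^ m + x)).symm

lemma sum_ite_val_lt (d : ZMod b) :
    ∑ e : ZMod b, (if e.val < d.val then (1 : ℝ) else 0) = d.val := by
  rw [sum_zmod_val fun e => if e < d.val then (1 : ℝ) else 0, ← Finset.sum_filter]
  have : (Finset.range b).filter (· < d.val) = Finset.range d.val := by
    ext e
    have := ZMod.val_lt d
    simp only [Finset.mem_filter, Finset.mem_range]
    omega
  simp [this]

/-! ### Shifted digit reversal -/

/-- `shiftRev b v m x` reverses the lowest `m` base `b` digits of `x` and adds `v` to each. -/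
def shiftRev (b : ℕ) (v : ZMod b) : ℕ → ℕ → ℕ
  | 0, _ => 0
  | m + 1, x => ((x : ZMod b) + v).val * b ^ m + shiftRev b v m (x / b)

lemma shiftRev_succ (v e : ZMod b) (m x : ℕ) :
    shiftRev b v (m + 1) (x * b + e.val) = (e + v).val * b ^ m + shiftRev b v m x := by
  have hb : 0 < b := Nat.pos_of_ne_zero (NeZero.ne b)
  have h1 : ((x * b + e.val : ℕ) : ZMod b) = e := by simp
  have h2 : (x * b + e.val) / b = x := by
    rw [add_comm, Nat.add_mul_div_right _ _ hb, Nat.div_eq_of_lt (ZMod.val_lt e), zero_add]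
  rw [shiftRev, h1, h2]

lemma val_mul_pow_add_lt (e : ZMod b) {m x : ℕ} (hx : x < b ^ m) :
    e.val * b ^ m + x < b ^ (m + 1) := by
  have h := Nat.mul_le_mul_right (b ^ m) (Nat.succ_le_of_lt (ZMod.val_lt e))
  rw [Nat.succ_mul] at h
  rw [pow_succ']
  omega

lemma shiftRev_lt (v : ZMod b) (m x : ℕ) : shiftRev b v m x < b ^ m := by
  induction m generalizing x with
  | zero => simp [shiftRev]
  | succ m ih => exact val_mul_pow_add_lt _ (ih _)

lemma val_mul_add_lt_iff {M : ℕ} {d e : ZMod b} {r s : ℕ} (hr : r < M) (hs : s < M) :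
    e.val * M + r < d.val * M + s ↔ e.val < d.val ∨ e = d ∧ r < s := by
  rcases lt_trichotomy e.val d.val with h | h | h
  · have := Nat.mul_le_mul_right M (Nat.succ_le_of_lt h)
    rw [Nat.succ_mul] at this
    simp only [h, true_or, iff_true]
    omega
  · have hed : e = d := ZMod.val_injective b h
    simp [hed]
  · have := Nat.mul_le_mul_right M (Nat.succ_le_of_lt h)
    rw [Nat.succ_mul] at this
    have hed : e ≠ d := fun h' => by simp [h'] at h
    simp only [hed, false_and, or_false]
    omega

lemma val_mul_add_inj {M : ℕ} {d e : ZMod b} {r s : ℕ} (hr : r < M) (hs : s < M)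
    (h : e.val * M + r = d.val * M + s) : e = d ∧ r = s := by
  have h1 := (val_mul_add_lt_iff (d := d) (e := e) hr hs).not.mp (by omega)
  have h2 := (val_mul_add_lt_iff (d := e) (e := d) hs hr).not.mp (by omega)
  have hed : e = d := ZMod.val_injective b (by omega)
  subst hed
  exact ⟨rfl, by omega⟩

lemma shiftRev_injOn (v : ZMod b) (m : ℕ) :
    Set.InjOn (shiftRev b v m) (Finset.range (b ^ m)) := by
  have hb : 0 < b := Nat.pos_of_ne_zero (NeZero.ne b)
  induction m with
  | zero =>
    intro x hx y hy _
    simp only [pow_zero, Finset.range_one, Finset.coe_singleton, Set.mem_singleton_iff] at hx hy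
    rw [hx, hy]
  | succ m ih =>
    intro x hx y hy h
    simp only [Finset.coe_range, Set.mem_Iio] at hx hy
    obtain ⟨h1, h2⟩ := val_mul_add_inj (shiftRev_lt _ _ _) (shiftRev_lt _ _ _) h
    have hdiv : x / b = y / b := by
      apply ih _ _ h2 <;> simp only [Finset.coe_range, Set.mem_Iio] <;>
        apply Nat.div_lt_of_lt_mul <;> rwa [← pow_succ']
    have hmod : x % b = y % b :=
      (ZMod.natCast_eq_natCast_iff' x y b).mp (add_right_cancel h1)
    rw [← Nat.div_add_mod x b, ← Nat.div_add_mod y b, hdiv, hmod]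

/-! ### The discrete discrepancy function -/

/-- Local error of the value `shiftRev b v m x` against the interval `[0, k)`. -/
def locErr (b m : ℕ) (v : ZMod b) (x k : ℕ) : ℝ :=
  (if shiftRev b v m x < k then 1 else 0) - k / (b : ℝ) ^ m

/-- `locErr` summed over all shifts. -/
def symErr (b m : ℕ) [NeZero b] (x k : ℕ) : ℝ := ∑ v : ZMod b, locErr b m v x k

/-- The unnormalized discrepancy of the points `(x, shiftRev b v m x)` in `[0, j) × [0, k)`,
summed over all shifts `v`. -/
def gridDisc (b m : ℕ) [NeZero b] (j k : ℕ) : ℝ := ∑ x ∈ Finset.range j, symErr b m x k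

/-- The average of `gridDisc` at `j` and `j + 1`, which is a martingale in `m`. -/
def midDisc (b m : ℕ) [NeZero b] (j k : ℕ) : ℝ := gridDisc b m j k + symErr b m j k / 2

lemma abs_locErr_le (v : ZMod b) {m k : ℕ} (x : ℕ) (hk : k < b ^ m) :
    |locErr b m v x k| ≤ 1 := by
  have hb : (0 : ℝ) < (b : ℝ) ^ m :=
    pow_pos (Nat.cast_pos.mpr (Nat.pos_of_ne_zero (NeZero.ne b))) m
  have h1 : (k : ℝ) / (b : ℝ) ^ m ≤ 1 := by
    rw [div_le_one hb]
    exact_mod_cast hk.le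
  have h0 : 0 ≤ (k : ℝ) / (b : ℝ) ^ m := by positivity
  unfold locErr
  split_ifs <;> rw [abs_le] <;> constructor <;> linarith

lemma abs_symErr_le {m k : ℕ} (x : ℕ) (hk : k < b ^ m) : |symErr b m x k| ≤ b := by
  refine (Finset.abs_sum_le_sum_abs _ _).trans ?_
  refine (Finset.sum_le_sum fun v _ => abs_locErr_le v x hk).trans ?_
  simp

lemma sum_locErr_sub (m x k : ℕ) (a : ZMod b) :
    ∑ d : ZMod b, locErr b m (d - a) x k = symErr b m x k :=
  Equiv.sum_comp (Equiv.subRight a) fun v => locErr b m v x k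

lemma sum_locErr_sub_left (m x k : ℕ) (d : ZMod b) :
    ∑ e : ZMod b, locErr b m (d - e) x k = symErr b m x k :=
  Equiv.sum_comp (Equiv.subLeft d) fun v => locErr b m v x k

lemma symErr_succ {m k : ℕ} (x : ℕ) (e d : ZMod b) (hk : k < b ^ m) :
    symErr b (m + 1) (x * b + e.val) (d.val * b ^ m + k) = locErr b m (d - e) x k := by
  have hb : (b : ℝ) ≠ 0 := Nat.cast_ne_zero.mpr (NeZero.ne b)
  have hsplit : ∀ v : ZMod b,
      (if shiftRev b v (m + 1) (x * b + e.val) < d.val * b ^ m + k then (1 : ℝ) else 0)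
        = (if (e + v).val < d.val then 1 else 0)
          + if v = d - e then (if shiftRev b (d - e) m x < k then 1 else 0) else 0 := by
    intro v
    rw [shiftRev_succ, if_congr (val_mul_add_lt_iff (shiftRev_lt _ _ _) hk) rfl rfl]
    have hv : e + v = d ↔ v = d - e := by rw [eq_sub_iff_add_eq']
    by_cases h : v = d - e
    · have : e + v = d := hv.mpr h
      simp [h]
    · simp [hv, h]
  have hlt : ∑ v : ZMod b, (if (e + v).val < d.val then (1 : ℝ) else 0) = d.val :=
    (Equiv.sum_comp (Equiv.addLeft e) fun v => if v.val < d.val then (1 : ℝ) else 0).trans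
      (sum_ite_val_lt d)
  unfold symErr locErr
  rw [Finset.sum_sub_distrib, Finset.sum_congr rfl fun v _ => hsplit v, Finset.sum_add_distrib,
    hlt, Finset.sum_ite_eq', if_pos (Finset.mem_univ _), Finset.sum_const,
    Finset.card_univ, ZMod.card, nsmul_eq_mul]
  push_cast
  field_simp
  ring

lemma gridDisc_succ {m k : ℕ} (j : ℕ) (c d : ZMod b) (hk : k < b ^ m) :
    gridDisc b (m + 1) (j * b + c.val) (d.val * b ^ m + k)
      = gridDisc b m j k + ∑ e ∈ Finset.range c.val, locErr b m (d - (e : ZMod b)) j k := by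
  unfold gridDisc
  rw [Finset.sum_range_add, sum_range_mul_eq]
  congr 1
  · refine Finset.sum_congr rfl fun x _ => ?_
    rw [← sum_zmod_val fun e => symErr b (m + 1) (x * b + e) (d.val * b ^ m + k),
      Finset.sum_congr rfl fun e _ => symErr_succ x e d hk, sum_locErr_sub_left]
  · refine Finset.sum_congr rfl fun e he => ?_
    have := symErr_succ j (e : ZMod b) d hk
    rwa [ZMod.val_cast_of_lt ((Finset.mem_range.mp he).trans (ZMod.val_lt c))] at this

/-- The increment of `midDisc` when a digit is appended to each coordinate. -/
def midInc (b m : ℕ) [NeZero b] (j k : ℕ) (c d : ZMod b) : ℝ :=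
  ∑ e ∈ Finset.range c.val, locErr b m (d - (e : ZMod b)) j k
    + locErr b m (d - c) j k / 2 - symErr b m j k / 2

lemma midDisc_succ {m k : ℕ} (j : ℕ) (c d : ZMod b) (hk : k < b ^ m) :
    midDisc b (m + 1) (j * b + c.val) (d.val * b ^ m + k)
      = midDisc b m j k + midInc b m j k c d := by
  unfold midDisc midInc
  rw [gridDisc_succ j c d hk, symErr_succ j c d hk]
  ring

lemma abs_midInc_le {m k : ℕ} (j : ℕ) (c d : ZMod b) (hk : k < b ^ m) :
    |midInc b m j k c d| ≤ 2 * b := by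
  have h1 : |∑ e ∈ Finset.range c.val, locErr b m (d - (e : ZMod b)) j k| ≤ c.val := by
    refine (Finset.abs_sum_le_sum_abs _ _).trans ?_
    refine (Finset.sum_le_sum fun (e : ℕ) _ => abs_locErr_le (d - (e : ZMod b)) j hk).trans ?_
    simp
  have h2 := abs_locErr_le (d - c) j hk
  have h3 := abs_symErr_le j hk
  have h4 : (c.val : ℝ) + 1 ≤ b := by exact_mod_cast ZMod.val_lt c
  unfold midInc
  rw [abs_le] at *
  constructor <;> linarith

lemma sum_midInc (m j k : ℕ) : ∑ c : ZMod b, ∑ d : ZMod b, midInc b m j k c d = 0 := by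
  have hd : ∀ c : ZMod b, ∑ d : ZMod b, midInc b m j k c d
      = ((c.val : ℝ) + 1 / 2 - b / 2) * symErr b m j k := by
    intro c
    unfold midInc
    rw [Finset.sum_sub_distrib, Finset.sum_add_distrib, Finset.sum_comm, ← Finset.sum_div,
      Finset.sum_congr rfl fun (e : ℕ) _ => sum_locErr_sub m j k (e : ZMod b), sum_locErr_sub]
    simp only [Finset.sum_const, Finset.card_range, Finset.card_univ, ZMod.card, nsmul_eq_mul]
    ring
  have hsq : ∀ n : ℕ, ∑ c ∈ Finset.range n, ((c : ℝ) + 1 / 2) = n ^ 2 / 2 := by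
    intro n
    induction n with
    | zero => simp
    | succ n ih =>
      rw [Finset.sum_range_succ, ih]
      push_cast
      ring
  rw [Finset.sum_congr rfl fun c _ => hd c, ← Finset.sum_mul, Finset.sum_sub_distrib,
    sum_zmod_val fun c => ((c : ℝ) + 1 / 2), hsq]
  simp only [Finset.sum_const, Finset.card_univ, ZMod.card, nsmul_eq_mul]
  ring

/-! ### Exponential moments -/

lemma sum_exp_le_of_sum_eq_zero {ι : Type*} (s : Finset ι) {z : ι → ℝ} {θ M : ℝ}
    (hz : ∀ i ∈ s, |z i| ≤ M) (hsum : ∑ i ∈ s, z i = 0) (hθ : |θ| * M ≤ 1) :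
    ∑ i ∈ s, Real.exp (θ * z i) ≤ s.card * Real.exp ((θ * M) ^ 2) := by
  have hpt : ∀ i ∈ s, Real.exp (θ * z i) ≤ 1 + θ * z i + (θ * M) ^ 2 := by
    intro i hi
    have habs : |θ * z i| ≤ |θ| * M := by
      rw [abs_mul]
      exact mul_le_mul_of_nonneg_left (hz i hi) (abs_nonneg θ)
    have h := (abs_le.mp (Real.abs_exp_sub_one_sub_id_le (habs.trans hθ))).2
    have hsq : (θ * z i) ^ 2 ≤ (θ * M) ^ 2 := by
      rw [← sq_abs (θ * z i), mul_pow θ M, ← sq_abs θ, ← mul_pow]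
      exact pow_le_pow_left₀ (abs_nonneg _) habs 2
    linarith
  calc ∑ i ∈ s, Real.exp (θ * z i) ≤ ∑ i ∈ s, (1 + θ * z i + (θ * M) ^ 2) :=
        Finset.sum_le_sum hpt
    _ = s.card * ((θ * M) ^ 2 + 1) := by
        rw [Finset.sum_add_distrib, Finset.sum_add_distrib, ← Finset.mul_sum, hsum]
        simp only [Finset.sum_const, nsmul_eq_mul]
        ring
    _ ≤ s.card * Real.exp ((θ * M) ^ 2) :=
        mul_le_mul_of_nonneg_left (Real.add_one_le_exp _) (Nat.cast_nonneg _)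

lemma sum_exp_midDisc_le {θ : ℝ} (hθ : |θ| * (2 * b) ≤ 1) (m : ℕ) :
    ∑ j ∈ Finset.range (b ^ m), ∑ k ∈ Finset.range (b ^ m), Real.exp (θ * midDisc b m j k)
      ≤ ((b : ℝ) ^ 2 * Real.exp ((θ * (2 * b)) ^ 2)) ^ m := by
  induction m with
  | zero => simp [midDisc, gridDisc, symErr, locErr]
  | succ m ih =>
    have hstep : ∀ j, ∀ k ∈ Finset.range (b ^ m),
        ∑ c : ZMod b, ∑ d : ZMod b,
          Real.exp (θ * midDisc b (m + 1) (j * b + c.val) (d.val * b ^ m + k))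
        ≤ Real.exp (θ * midDisc b m j k) * ((b : ℝ) ^ 2 * Real.exp ((θ * (2 * b)) ^ 2)) := by
      intro j k hk
      have hk' := Finset.mem_range.mp hk
      have h := sum_exp_le_of_sum_eq_zero (Finset.univ : Finset (ZMod b × ZMod b))
        (z := fun i => midInc b m j k i.1 i.2) (θ := θ) (M := 2 * b)
        (fun i _ => abs_midInc_le j i.1 i.2 hk')
        (by rw [Fintype.sum_prod_type]; exact sum_midInc m j k) hθ
      rw [Fintype.sum_prod_type, Finset.card_univ, Fintype.card_prod, ZMod.card] at h
      simp only [midDisc_succ j _ _ hk', mul_add, Real.exp_add, ← Finset.mul_sum]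
      refine mul_le_mul_of_nonneg_left (h.trans_eq ?_) (Real.exp_nonneg _)
      push_cast
      ring
    calc ∑ j ∈ Finset.range (b ^ (m + 1)), ∑ k ∈ Finset.range (b ^ (m + 1)),
          Real.exp (θ * midDisc b (m + 1) j k)
        = ∑ j ∈ Finset.range (b ^ m), ∑ k ∈ Finset.range (b ^ m), ∑ c : ZMod b, ∑ d : ZMod b,
          Real.exp (θ * midDisc b (m + 1) (j * b + c.val) (d.val * b ^ m + k)) := by
          rw [sum_range_pow_succ_low]
          refine Finset.sum_congr rfl fun j _ => ?_
          simp only [sum_range_pow_succ_high]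
          rw [Finset.sum_congr rfl fun c _ => Finset.sum_comm, Finset.sum_comm]
      _ ≤ ∑ j ∈ Finset.range (b ^ m), ∑ k ∈ Finset.range (b ^ m),
          Real.exp (θ * midDisc b m j k) * ((b : ℝ) ^ 2 * Real.exp ((θ * (2 * b)) ^ 2)) :=
          Finset.sum_le_sum fun j _ => Finset.sum_le_sum fun k hk => hstep j k hk
      _ ≤ _ := by
          simp only [← Finset.sum_mul]
          rw [pow_succ]
          exact mul_le_mul_of_nonneg_right ih (by positivity)

/-! ### The integer parts of the points -/

/-- `b ^ m` times the first coordinate, truncated to `m` digits, of the point with index `u`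
and shift `l`. -/
def lead₁ (b m : ℕ) (l : ZMod b) (u : ℕ) : ℕ :=
  ∑ i ∈ Finset.range m, (zdgt b u i + l).val * b ^ (m - 1 - i)

/-- `b ^ m` times the second coordinate, truncated to `m` digits, of the point with index `u`
and shift `l`. -/
def lead₂ (b m : ℕ) (l : ZMod b) (u : ℕ) : ℕ :=
  ∑ i ∈ Finset.range m, (zdgt b u i + l).val * b ^ i

lemma zdgt_val_mul_pow_add_of_lt (e : ZMod b) {m i : ℕ} (u : ℕ) (hi : i < m) :
    zdgt b (e.val * b ^ m + u) i = zdgt b u i := by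
  unfold zdgt dgt
  obtain ⟨r, rfl⟩ := Nat.exists_eq_add_of_lt hi
  have hb : 0 < b ^ i := Nat.pow_pos (Nat.pos_of_ne_zero (NeZero.ne b))
  rw [show e.val * b ^ (i + r + 1) + u = u + e.val * b ^ r * b * b ^ i by ring,
    Nat.add_mul_div_right _ _ hb, Nat.add_mul_mod_self_right]

lemma zdgt_val_mul_pow_add (e : ZMod b) {m u : ℕ} (hu : u < b ^ m) :
    zdgt b (e.val * b ^ m + u) m = e := by
  unfold zdgt dgt
  have hb : 0 < b ^ m := Nat.pow_pos (Nat.pos_of_ne_zero (NeZero.ne b))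
  rw [add_comm, Nat.add_mul_div_right _ _ hb, Nat.div_eq_of_lt hu, zero_add,
    Nat.mod_eq_of_lt (ZMod.val_lt e), ZMod.natCast_val, ZMod.cast_id]

lemma lead₁_val_mul_pow_add (l e : ZMod b) {m n : ℕ} (u : ℕ) (hmn : m ≤ n) :
    lead₁ b m l (e.val * b ^ n + u) = lead₁ b m l u := by
  refine Finset.sum_congr rfl fun i hi => ?_
  rw [zdgt_val_mul_pow_add_of_lt e u ((Finset.mem_range.mp hi).trans_le hmn)]

lemma lead₂_val_mul_pow_add (l e : ZMod b) {m n : ℕ} (u : ℕ) (hmn : m ≤ n) :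
    lead₂ b m l (e.val * b ^ n + u) = lead₂ b m l u := by
  refine Finset.sum_congr rfl fun i hi => ?_
  rw [zdgt_val_mul_pow_add_of_lt e u ((Finset.mem_range.mp hi).trans_le hmn)]

lemma lead₁_succ (l e : ZMod b) {m u : ℕ} (hu : u < b ^ m) :
    lead₁ b (m + 1) l (e.val * b ^ m + u) = lead₁ b m l u * b + (e + l).val := by
  rw [lead₁, Finset.sum_range_succ, zdgt_val_mul_pow_add e hu, lead₁, Finset.sum_mul]
  congr 1
  · refine Finset.sum_congr rfl fun i hi => ?_
    have him := Finset.mem_range.mp hi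
    rw [zdgt_val_mul_pow_add_of_lt e u him, mul_assoc, ← pow_succ,
      show m + 1 - 1 - i = m - 1 - i + 1 by omega]
  · simp

lemma lead₂_succ (l e : ZMod b) {m u : ℕ} (hu : u < b ^ m) :
    lead₂ b (m + 1) l (e.val * b ^ m + u) = (e + l).val * b ^ m + lead₂ b m l u := by
  rw [lead₂, Finset.sum_range_succ, zdgt_val_mul_pow_add e hu, add_comm,
    ← lead₂_val_mul_pow_add l e u le_rfl, lead₂]

lemma sum_lead_eq (m : ℕ) (l₁ l₂ : ZMod b) (F : ℕ → ℕ → ℝ) :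
    ∑ u ∈ Finset.range (b ^ m), F (lead₁ b m l₁ u) (lead₂ b m l₂ u)
      = ∑ x ∈ Finset.range (b ^ m), F x (shiftRev b (l₂ - l₁) m x) := by
  induction m generalizing F with
  | zero => simp [lead₁, lead₂, shiftRev]
  | succ m ih =>
    have h : ∀ u ∈ Finset.range (b ^ m),
        ∑ e : ZMod b, F (lead₁ b (m + 1) l₁ (e.val * b ^ m + u))
            (lead₂ b (m + 1) l₂ (e.val * b ^ m + u))
          = ∑ e : ZMod b, F (lead₁ b m l₁ u * b + e.val)
            ((e + (l₂ - l₁)).val * b ^ m + lead₂ b m l₂ u) := by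
      intro u hu
      rw [← Equiv.sum_comp (Equiv.subRight l₁)]
      refine Finset.sum_congr rfl fun e _ => ?_
      rw [lead₁_succ _ _ (Finset.mem_range.mp hu), lead₂_succ _ _ (Finset.mem_range.mp hu),
        Equiv.subRight_apply, sub_add_cancel, sub_add_eq_add_sub, add_sub_assoc]
    rw [sum_range_pow_succ_high, Finset.sum_comm, Finset.sum_congr rfl h,
      ih fun x y => ∑ e : ZMod b, F (x * b + e.val) ((e + (l₂ - l₁)).val * b ^ m + y),
      sum_range_pow_succ_low]
    simp only [shiftRev_succ]

lemma sum_points_eq (m : ℕ) (F : ℕ → ℕ → ℝ) :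
    ∑ u ∈ Finset.range (b ^ (m + 2)),
        F (lead₁ b m (zdgt b u m) u) (lead₂ b m (zdgt b u (m + 1)) u)
      = b * ∑ x ∈ Finset.range (b ^ m), ∑ v : ZMod b, F x (shiftRev b v m x) := by
  have h : ∀ l₂ l₁ : ZMod b, ∀ u ∈ Finset.range (b ^ m),
      F (lead₁ b m (zdgt b (l₂.val * b ^ (m + 1) + (l₁.val * b ^ m + u)) m)
          (l₂.val * b ^ (m + 1) + (l₁.val * b ^ m + u)))
        (lead₂ b m (zdgt b (l₂.val * b ^ (m + 1) + (l₁.val * b ^ m + u)) (m + 1))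
          (l₂.val * b ^ (m + 1) + (l₁.val * b ^ m + u)))
      = F (lead₁ b m l₁ u) (lead₂ b m l₂ u) := by
    intro l₂ l₁ u hu
    have hu' := Finset.mem_range.mp hu
    rw [zdgt_val_mul_pow_add_of_lt _ _ m.lt_succ_self, zdgt_val_mul_pow_add _ hu',
      zdgt_val_mul_pow_add _ (val_mul_pow_add_lt _ hu'),
      lead₁_val_mul_pow_add _ _ _ m.le_succ, lead₁_val_mul_pow_add _ _ _ le_rfl,
      lead₂_val_mul_pow_add _ _ _ m.le_succ, lead₂_val_mul_pow_add _ _ _ le_rfl]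
  simp only [sum_range_pow_succ_high (m + 1), sum_range_pow_succ_high m]
  rw [Finset.sum_congr rfl fun l₂ _ => Finset.sum_congr rfl fun l₁ _ =>
    Finset.sum_congr rfl (h l₂ l₁)]
  simp only [sum_lead_eq]
  rw [Finset.sum_comm]
  have hshift : ∀ l₁ : ZMod b,
      ∑ l₂ : ZMod b, ∑ x ∈ Finset.range (b ^ m), F x (shiftRev b (l₂ - l₁) m x)
        = ∑ x ∈ Finset.range (b ^ m), ∑ v : ZMod b, F x (shiftRev b v m x) := by
    intro l₁
    rw [Finset.sum_comm (s := Finset.range (b ^ m))]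
    exact Equiv.sum_comp (Equiv.subRight l₁)
      fun v => ∑ x ∈ Finset.range (b ^ m), F x (shiftRev b v m x)
  rw [Finset.sum_congr rfl fun l₁ _ => hshift l₁]
  simp

lemma count_lt_lt_eq {m j k : ℕ} (hj : j ≤ b ^ m) :
    ∑ x ∈ Finset.range (b ^ m), ∑ v : ZMod b,
        (if x < j ∧ shiftRev b v m x < k then (1 : ℝ) else 0)
      = gridDisc b m j k + j * (b * (k / (b : ℝ) ^ m)) := by
  unfold gridDisc symErr locErr
  rw [← Finset.sum_subset (Finset.range_mono hj)]
  · simp only [Finset.sum_sub_distrib, Finset.sum_const, Finset.card_univ, ZMod.card,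
      Finset.card_range, nsmul_eq_mul, sub_add_cancel]
    refine Finset.sum_congr rfl fun x hx => Finset.sum_congr rfl fun v _ => ?_
    simp [Finset.mem_range.mp hx]
  · intro x _ hx
    simp [Finset.mem_range.not.mp hx]

lemma count_eq_left_le (m j : ℕ) :
    ∑ x ∈ Finset.range (b ^ m), ∑ _v : ZMod b, (if x = j then (1 : ℝ) else 0) ≤ b := by
  rw [Finset.sum_comm]
  refine (Finset.sum_le_sum (g := fun _ => (1 : ℝ)) fun v _ => ?_).trans (by simp)
  rw [Finset.sum_ite_eq']
  split_ifs <;> norm_num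

lemma count_eq_right_le (m k : ℕ) :
    ∑ x ∈ Finset.range (b ^ m), ∑ v : ZMod b, (if shiftRev b v m x = k then (1 : ℝ) else 0)
      ≤ b := by
  rw [Finset.sum_comm]
  refine (Finset.sum_le_sum (g := fun _ => (1 : ℝ)) fun v _ => ?_).trans (by simp)
  rw [← Finset.sum_image (f := fun y => if y = k then (1 : ℝ) else 0) (shiftRev_injOn v m),
    Finset.sum_ite_eq']
  split_ifs <;> norm_num

lemma sum_digits_bounds {w : ℕ → ℕ} (hw : ∀ i, w i < b) {m n : ℕ} (hmn : m ≤ n) :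
    (∑ i ∈ Finset.range m, w i * b ^ (m - 1 - i) : ℕ) / (b : ℝ) ^ m
        ≤ ∑ i ∈ Finset.range n, (w i : ℝ) / (b : ℝ) ^ (i + 1) ∧
      ∑ i ∈ Finset.range n, (w i : ℝ) / (b : ℝ) ^ (i + 1)
        < ((∑ i ∈ Finset.range m, w i * b ^ (m - 1 - i) : ℕ) + 1) / (b : ℝ) ^ m := by
  have hb : (0 : ℝ) < b := Nat.cast_pos.mpr (Nat.pos_of_ne_zero (NeZero.ne b))
  have hm : ((∑ i ∈ Finset.range m, w i * b ^ (m - 1 - i) : ℕ) : ℝ) / (b : ℝ) ^ m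
      = ∑ i ∈ Finset.range m, (w i : ℝ) / (b : ℝ) ^ (i + 1) := by
    rw [Nat.cast_sum, Finset.sum_div]
    refine Finset.sum_congr rfl fun i hi => ?_
    have him := Finset.mem_range.mp hi
    have hpow : (b : ℝ) ^ m = (b : ℝ) ^ (m - 1 - i) * (b : ℝ) ^ (i + 1) := by
      rw [← pow_add]
      congr 1
      omega
    push_cast
    rw [hpow]
    field_simp
  rw [add_div, hm]
  have htail : ∑ i ∈ Finset.range n, (w i : ℝ) / (b : ℝ) ^ (i + 1) + 1 / (b : ℝ) ^ n
      ≤ ∑ i ∈ Finset.range m, (w i : ℝ) / (b : ℝ) ^ (i + 1) + 1 / (b : ℝ) ^ m := by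
    induction n, hmn using Nat.le_induction with
    | base => rfl
    | succ n _ ih =>
      refine le_trans ?_ ih
      rw [Finset.sum_range_succ, add_assoc, ← add_div]
      gcongr _ + ?_
      have h1 : (w n : ℝ) + 1 ≤ b := by exact_mod_cast hw n
      rw [div_le_div_iff₀ (by positivity) (by positivity), pow_succ]
      nlinarith [pow_pos hb n]
  constructor
  · exact Finset.sum_le_sum_of_subset_of_nonneg (Finset.range_mono hmn)
      fun i _ _ => by positivity
  · have : 0 < 1 / (b : ℝ) ^ n := by positivity
    linarith

lemma first_coord_bounds {m n : ℕ} (hmn : m ≤ n) (u : ℕ) :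
    lead₁ b m (zdgt b u m) u / (b : ℝ) ^ m
        ≤ ∑ i ∈ Finset.range n, ((∑ t : Fin (m + 2), zdgt b u (t : ℕ)
          * hamRow1 b m (i + 1) t).val : ℝ) / (b : ℝ) ^ (i + 1) ∧
      ∑ i ∈ Finset.range n, ((∑ t : Fin (m + 2), zdgt b u (t : ℕ)
          * hamRow1 b m (i + 1) t).val : ℝ) / (b : ℝ) ^ (i + 1)
        < (lead₁ b m (zdgt b u m) u + 1) / (b : ℝ) ^ m := by
  have h := sum_digits_bounds
    (fun i => ZMod.val_lt (∑ t : Fin (m + 2), zdgt b u (t : ℕ) * hamRow1 b m (i + 1) t)) hmn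
  have hlead : ∑ i ∈ Finset.range m, (∑ t : Fin (m + 2), zdgt b u (t : ℕ)
      * hamRow1 b m (i + 1) t).val * b ^ (m - 1 - i) = lead₁ b m (zdgt b u m) u := by
    refine Finset.sum_congr rfl fun i hi => ?_
    rw [sum_mul_hamRow1 b m i (zdgt b u), if_pos (Finset.mem_range.mp hi)]
  rwa [hlead] at h

lemma second_coord_bounds {m n : ℕ} (hmn : m ≤ n) (u : ℕ) :
    lead₂ b m (zdgt b u (m + 1)) u / (b : ℝ) ^ m
        ≤ ∑ i ∈ Finset.range n, ((∑ t : Fin (m + 2), zdgt b u (t : ℕ)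
          * hamRow2 b m (i + 1) t).val : ℝ) / (b : ℝ) ^ (i + 1) ∧
      ∑ i ∈ Finset.range n, ((∑ t : Fin (m + 2), zdgt b u (t : ℕ)
          * hamRow2 b m (i + 1) t).val : ℝ) / (b : ℝ) ^ (i + 1)
        < (lead₂ b m (zdgt b u (m + 1)) u + 1) / (b : ℝ) ^ m := by
  have h := sum_digits_bounds
    (fun i => ZMod.val_lt (∑ t : Fin (m + 2), zdgt b u (t : ℕ) * hamRow2 b m (i + 1) t)) hmn
  have hlead : ∑ i ∈ Finset.range m, (∑ t : Fin (m + 2), zdgt b u (t : ℕ)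
      * hamRow2 b m (i + 1) t).val * b ^ (m - 1 - i) = lead₂ b m (zdgt b u (m + 1)) u := by
    rw [lead₂, ← Finset.sum_range_reflect]
    refine Finset.sum_congr rfl fun i hi => ?_
    have him := Finset.mem_range.mp hi
    rw [sum_mul_hamRow2 b m (m - 1 - i) (zdgt b u), if_pos (by omega),
      show m - 1 - (m - 1 - i) = i by omega]
  rwa [hlead] at h

/-! ### Pointwise bound for the local discrepancy -/

lemma abs_disc2_truncHamPts_le {m n j k : ℕ} (hmn : m ≤ n) (hj : j < b ^ m) (hk : k < b ^ m)
    {t : ℝ × ℝ} (ht₁ : j / (b : ℝ) ^ m ≤ t.1) (ht₁' : t.1 ≤ (j + 1) / (b : ℝ) ^ m)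
    (ht₂ : k / (b : ℝ) ^ m ≤ t.2) (ht₂' : t.2 ≤ (k + 1) / (b : ℝ) ^ m) :
    (b : ℝ) ^ (m + 2) * |disc2 (truncHamPts b m n) t| ≤ b * |midDisc b m j k| + 4 * b ^ 2 := by
  have hb : (0 : ℝ) < b := Nat.cast_pos.mpr (Nat.pos_of_ne_zero (NeZero.ne b))
  have hbm : (0 : ℝ) < (b : ℝ) ^ m := by positivity
  rw [disc2_truncHamPts]
  set cnt : ℝ := ∑ u ∈ Finset.range (b ^ (m + 2)), _ with hcnt
  have hlow : b * (gridDisc b m j k + j * (b * (k / (b : ℝ) ^ m))) ≤ cnt := by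
    rw [← count_lt_lt_eq hj.le,
      ← sum_points_eq m fun x y => if x < j ∧ y < k then (1 : ℝ) else 0]
    refine Finset.sum_le_sum fun u _ => ?_
    have h1 := (first_coord_bounds (b := b) hmn u).2
    have h2 := (second_coord_bounds (b := b) hmn u).2
    split_ifs with h h'
    · exact le_rfl
    · refine absurd ⟨h1.trans_le (le_trans ?_ ht₁), h2.trans_le (le_trans ?_ ht₂)⟩ h' <;> gcongr
      · exact_mod_cast h.1
      · exact_mod_cast h.2
    · norm_num
    · exact le_rfl
  have hupp : cnt ≤ b * (gridDisc b m j k + j * (b * (k / (b : ℝ) ^ m)) + b + b) := by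
    have hsum : cnt ≤ b * ∑ x ∈ Finset.range (b ^ m), ∑ v : ZMod b,
        ((if x < j ∧ shiftRev b v m x < k then (1 : ℝ) else 0) + (if x = j then 1 else 0)
          + if shiftRev b v m x = k then 1 else 0) := by
      rw [← sum_points_eq m fun x y => (if x < j ∧ y < k then (1 : ℝ) else 0)
        + (if x = j then 1 else 0) + if y = k then 1 else 0]
      refine Finset.sum_le_sum fun u _ => ?_
      have h1 := (first_coord_bounds (b := b) hmn u).1
      have h2 := (second_coord_bounds (b := b) hmn u).1
      split_ifs with h <;> try norm_num
      have h1' := (h1.trans_lt h.1).trans_le ht₁'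
      have h2' := (h2.trans_lt h.2).trans_le ht₂'
      rw [div_lt_div_iff_of_pos_right hbm] at h1' h2'
      norm_cast at h1' h2'
      omega
    refine hsum.trans (mul_le_mul_of_nonneg_left ?_ hb.le)
    simp only [Finset.sum_add_distrib]
    exact add_le_add (add_le_add (count_lt_lt_eq hj.le).le (count_eq_left_le m j))
      (count_eq_right_le m k)
  have hmid : |gridDisc b m j k| ≤ |midDisc b m j k| + b := by
    have h := abs_symErr_le j hk
    have : gridDisc b m j k = midDisc b m j k - symErr b m j k / 2 := by
      unfold midDisc
      ring
    rw [this]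
    refine (abs_sub _ _).trans ?_
    rw [abs_div, abs_two]
    linarith
  have ht1 : 0 ≤ t.1 := le_trans (by positivity) ht₁
  have ht2 : 0 ≤ t.2 := le_trans (by positivity) ht₂
  have hprodlow : (j : ℝ) * (k / (b : ℝ) ^ m) ≤ (b : ℝ) ^ m * (t.1 * t.2) := by
    calc (j : ℝ) * (k / (b : ℝ) ^ m)
        = (b : ℝ) ^ m * (j / (b : ℝ) ^ m * (k / (b : ℝ) ^ m)) := by field_simp
      _ ≤ _ := by gcongr
  have hprodupp : (b : ℝ) ^ m * (t.1 * t.2) ≤ j * (k / (b : ℝ) ^ m) + 2 := by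
    calc (b : ℝ) ^ m * (t.1 * t.2)
        ≤ (b : ℝ) ^ m * ((j + 1) / (b : ℝ) ^ m * ((k + 1) / (b : ℝ) ^ m)) := by gcongr
      _ = j * (k / (b : ℝ) ^ m) + (j + 1 + k) / (b : ℝ) ^ m := by
          field_simp
          ring
      _ ≤ _ := by
          gcongr
          rw [div_le_iff₀ hbm]
          have h1 : (j : ℝ) + 1 ≤ (b : ℝ) ^ m := by exact_mod_cast hj
          have h2 : (k : ℝ) ≤ (b : ℝ) ^ m := by exact_mod_cast hk.le
          linarith
  have hN : (b : ℝ) ^ (m + 2) * (cnt / (b : ℝ) ^ (m + 2) - t.1 * t.2)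
      = cnt - b ^ 2 * ((b : ℝ) ^ m * (t.1 * t.2)) := by
    field_simp
    ring
  rw [← abs_of_pos (show (0 : ℝ) < (b : ℝ) ^ (m + 2) by positivity), ← abs_mul,
    abs_of_pos (show (0 : ℝ) < (b : ℝ) ^ (m + 2) by positivity), hN]
  have hb2 : (0 : ℝ) ≤ (b : ℝ) ^ 2 := by positivity
  have p1 := mul_le_mul_of_nonneg_left hprodlow hb2
  have p2 := mul_le_mul_of_nonneg_left hprodupp hb2
  obtain ⟨g1, g2⟩ := abs_le.mp hmid
  have q1 := mul_le_mul_of_nonneg_left g1 hb.le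
  have q2 := mul_le_mul_of_nonneg_left g2 hb.le
  rw [abs_le]
  constructor <;> nlinarith

end ZModSums

/-! ### Integration over a grid of cells -/

lemma exists_cell {M : ℕ} (hM : 0 < M) {x : ℝ} (h0 : 0 ≤ x) (h1 : x ≤ 1) :
    ∃ j < M, (j : ℝ) / M ≤ x ∧ x ≤ (j + 1) / M := by
  have hM' : (0 : ℝ) < M := Nat.cast_pos.mpr hM
  rcases h1.lt_or_eq with h | rfl
  · refine ⟨⌊x * M⌋₊, ?_, ?_, ?_⟩
    · rw [Nat.floor_lt (by positivity)]
      nlinarith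
    · rw [div_le_iff₀ hM']
      exact Nat.floor_le (by positivity)
    · rw [le_div_iff₀ hM']
      exact (Nat.lt_floor_add_one _).le
  · refine ⟨M - 1, by omega, ?_, ?_⟩
    · rw [div_le_one hM']
      exact_mod_cast M.sub_le 1
    · rw [one_le_div hM']
      exact_mod_cast (by omega : M ≤ M - 1 + 1)

lemma setIntegral_unitSquare_le {f : ℝ × ℝ → ℝ} (hf : ∀ t, 0 ≤ f t) {M : ℕ} (hM : 0 < M)
    {F : ℕ → ℕ → ℝ} (hF : ∀ j k, 0 ≤ F j k)
    (hfF : ∀ j < M, ∀ k < M, ∀ t : ℝ × ℝ, (j : ℝ) / M ≤ t.1 → t.1 ≤ (j + 1) / M →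
      (k : ℝ) / M ≤ t.2 → t.2 ≤ (k + 1) / M → f t ≤ F j k) :
    ∫ t in Set.Icc ((0 : ℝ), (0 : ℝ)) (1, 1), f t
      ≤ (∑ j ∈ Finset.range M, ∑ k ∈ Finset.range M, F j k) / (M : ℝ) ^ 2 := by
  have hM' : (0 : ℝ) < M := Nat.cast_pos.mpr hM
  let cell : ℕ → ℕ → Set (ℝ × ℝ) := fun j k =>
    Set.Icc ((j : ℝ) / M) ((j + 1) / M) ×ˢ Set.Icc ((k : ℝ) / M) ((k + 1) / M)
  have hmeas : ∀ j k, MeasurableSet (cell j k) := fun j k =>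
    measurableSet_Icc.prod measurableSet_Icc
  have hvol : ∀ j k, volume.real (cell j k) = 1 / (M : ℝ) ^ 2 := by
    intro j k
    have hside : ∀ i : ℕ, volume.real (Set.Icc ((i : ℝ) / M) ((i + 1) / M)) = 1 / M := by
      intro i
      rw [Real.volume_real_Icc_of_le (by gcongr; linarith)]
      ring
    rw [Measure.volume_eq_prod, measureReal_prod_prod, hside, hside]
    field_simp
  let g : ℕ → ℕ → ℝ × ℝ → ℝ := fun j k => (cell j k).indicator fun _ => F j k
  have hg0 : ∀ j k t, 0 ≤ g j k t := fun j k t => Set.indicator_nonneg (fun _ _ => hF j k) t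
  have hgint : ∀ j k, Integrable (g j k) volume := by
    intro j k
    refine (integrable_indicator_iff (hmeas j k)).mpr (integrableOn_const ?_)
    exact (isCompact_Icc.prod isCompact_Icc).measure_lt_top.ne
  have hsumint : Integrable
      (fun t => ∑ j ∈ Finset.range M, ∑ k ∈ Finset.range M, g j k t) volume :=
    integrable_finsetSum _ fun j _ => integrable_finsetSum _ fun k _ => hgint j k
  calc ∫ t in Set.Icc ((0 : ℝ), (0 : ℝ)) (1, 1), f t
      ≤ ∫ t in Set.Icc ((0 : ℝ), (0 : ℝ)) (1, 1),
          ∑ j ∈ Finset.range M, ∑ k ∈ Finset.range M, g j k t := by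
        refine integral_mono_of_nonneg (ae_of_all _ hf) hsumint.integrableOn ?_
        refine (ae_restrict_iff' measurableSet_Icc).mpr (ae_of_all _ fun t ht => ?_)
        obtain ⟨j, hj, hj1, hj2⟩ := exists_cell hM ht.1.1 ht.2.1
        obtain ⟨k, hk, hk1, hk2⟩ := exists_cell hM ht.1.2 ht.2.2
        have hgt : g j k t = F j k :=
          Set.indicator_of_mem (show t ∈ cell j k from ⟨⟨hj1, hj2⟩, ⟨hk1, hk2⟩⟩) _
        calc f t ≤ g j k t := hgt ▸ hfF j hj k hk t hj1 hj2 hk1 hk2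
          _ ≤ ∑ k ∈ Finset.range M, g j k t :=
            Finset.single_le_sum (f := fun k => g j k t) (fun k _ => hg0 j k t)
              (Finset.mem_range.mpr hk)
          _ ≤ _ := Finset.single_le_sum (f := fun j => ∑ k ∈ Finset.range M, g j k t)
            (fun j _ => Finset.sum_nonneg fun k _ => hg0 j k t) (Finset.mem_range.mpr hj)
    _ ≤ ∫ t, ∑ j ∈ Finset.range M, ∑ k ∈ Finset.range M, g j k t :=
        setIntegral_le_integral hsumint (ae_of_all _ fun t =>
          Finset.sum_nonneg fun j _ => Finset.sum_nonneg fun k _ => hg0 j k t)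
    _ = _ := by
        rw [integral_finsetSum _ fun j _ => integrable_finsetSum _ fun k _ => hgint j k,
          Finset.sum_div]
        refine Finset.sum_congr rfl fun j _ => ?_
        rw [integral_finsetSum _ fun k _ => hgint j k, Finset.sum_div]
        refine Finset.sum_congr rfl fun k _ => ?_
        rw [integral_indicator_const _ (hmeas j k), hvol, smul_eq_mul]
        ring

/-! ### The `L_p` discrepancy bound -/

lemma exists_rpow_le_mul_exp (p : ℝ) (hp : 0 ≤ p) :
    ∃ K : ℝ, 0 < K ∧ ∀ x : ℝ, 0 ≤ x → x ^ p ≤ K * Real.exp x := by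
  obtain ⟨q, hq⟩ := exists_nat_ge p
  refine ⟨1 + q.factorial, by positivity, fun x hx => ?_⟩
  have hfac : (0 : ℝ) < q.factorial := by positivity
  rcases le_total x 1 with h | h
  · have h1 : x ^ p ≤ 1 := Real.rpow_le_one hx h hp
    have h2 : 1 ≤ Real.exp x := Real.one_le_exp hx
    nlinarith
  · have h1 : x ^ p ≤ x ^ q := by
      rw [← Real.rpow_natCast]
      exact Real.rpow_le_rpow_of_exponent_le h hq
    have h2 := Real.pow_div_factorial_le_exp x hx q
    rw [div_le_iff₀ hfac] at h2
    have := Real.exp_pos x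
    nlinarith

lemma LpDisc_truncHamPts_le {b : ℕ} [NeZero b] {p K : ℝ} (hp : 0 < p) (hK : 0 < K)
    (hKexp : ∀ x : ℝ, 0 ≤ x → x ^ p ≤ K * Real.exp x) {m n : ℕ} (hmn : m ≤ n) :
    LpDisc p (truncHamPts b m n)
      ≤ 2 * b ^ 2 * (2 * K * Real.exp 3) ^ (1 / p) * Real.sqrt ((m : ℝ) + 2)
        / (b : ℝ) ^ (m + 2) := by
  have hb : (0 : ℝ) < b := Nat.cast_pos.mpr (Nat.pos_of_ne_zero (NeZero.ne b))
  set r := Real.sqrt ((m : ℝ) + 2) with hr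
  have hr2 : r ^ 2 = m + 2 := Real.sq_sqrt (by positivity)
  have hr1 : 1 ≤ r := Real.one_le_sqrt.mpr (by linarith [(Nat.cast_nonneg m : (0 : ℝ) ≤ m)])
  have hr0 : 0 < r := by linarith
  set θ := 1 / (2 * b * r) with hθdef
  have hθ0 : 0 < θ := by positivity
  have hθb : θ * (2 * b) = 1 / r := by
    rw [hθdef]
    field_simp
  have hθb1 : θ * (2 * b) ≤ 1 := by
    rw [hθb, div_le_one hr0]
    exact hr1
  set s := θ / b * (b : ℝ) ^ (m + 2) with hsdef
  have hs0 : 0 < s := by positivity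
  have hsinv : s⁻¹ = 2 * b ^ 2 * r / (b : ℝ) ^ (m + 2) := by
    rw [hsdef, hθdef]
    field_simp
  let F : ℕ → ℕ → ℝ := fun j k => s⁻¹ ^ p * (K * Real.exp 2 *
    (Real.exp (θ * midDisc b m j k) + Real.exp (-θ * midDisc b m j k)))
  have hpt : ∀ j < b ^ m, ∀ k < b ^ m, ∀ t : ℝ × ℝ, (j : ℝ) / (b ^ m : ℕ) ≤ t.1 →
      t.1 ≤ (j + 1) / (b ^ m : ℕ) → (k : ℝ) / (b ^ m : ℕ) ≤ t.2 → t.2 ≤ (k + 1) / (b ^ m : ℕ) →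
      |disc2 (truncHamPts b m n) t| ^ p ≤ F j k := by
    intro j hj k hk t h1 h2 h3 h4
    rw [Nat.cast_pow] at h1 h2 h3 h4
    have hbound := abs_disc2_truncHamPts_le hmn hj hk h1 h2 h3 h4
    set δ := |disc2 (truncHamPts b m n) t|
    have hδ0 : 0 ≤ δ := abs_nonneg _
    have hsδ : s * δ ≤ 2 + |θ * midDisc b m j k| := by
      rw [abs_mul, abs_of_pos hθ0]
      calc s * δ = θ / b * ((b : ℝ) ^ (m + 2) * δ) := by rw [hsdef]; ring
        _ ≤ θ / b * (b * |midDisc b m j k| + 4 * b ^ 2) := by gcongr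
        _ = 2 * (θ * (2 * b)) + θ * |midDisc b m j k| := by
            field_simp
            ring
        _ ≤ _ := by linarith
    have hexp : Real.exp |θ * midDisc b m j k|
        ≤ Real.exp (θ * midDisc b m j k) + Real.exp (-θ * midDisc b m j k) := by
      rw [neg_mul]
      exact Real.exp_abs_le _
    calc δ ^ p = s⁻¹ ^ p * (s * δ) ^ p := by
          rw [← Real.mul_rpow (by positivity) (by positivity), inv_mul_cancel_left₀ hs0.ne']
      _ ≤ s⁻¹ ^ p * (K * Real.exp (2 + |θ * midDisc b m j k|)) := by
          gcongr
          exact (hKexp _ (by positivity)).trans (by gcongr)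
      _ ≤ F j k := by
          rw [Real.exp_add, ← mul_assoc K]
          simp only [F]
          gcongr
  have hsumexp : ∀ ϑ : ℝ, |ϑ| = θ → ∑ j ∈ Finset.range (b ^ m), ∑ k ∈ Finset.range (b ^ m),
      Real.exp (ϑ * midDisc b m j k) ≤ (b : ℝ) ^ (2 * m) * Real.exp 1 := by
    intro ϑ hϑ
    refine (sum_exp_midDisc_le (by rwa [hϑ]) m).trans ?_
    have hsq : (ϑ * (2 * b)) ^ 2 = 1 / (m + 2) := by
      rw [mul_pow, ← sq_abs ϑ, hϑ, ← mul_pow, hθb, div_pow, one_pow, hr2]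
    rw [mul_pow, ← pow_mul, hsq, ← Real.exp_nat_mul]
    gcongr
    rw [mul_one_div, div_le_one (by positivity)]
    linarith
  have hintegral : ∫ t in Set.Icc ((0 : ℝ), (0 : ℝ)) (1, 1), |disc2 (truncHamPts b m n) t| ^ p
      ≤ s⁻¹ ^ p * (2 * K * Real.exp 3) := by
    refine (setIntegral_unitSquare_le (fun t => by positivity) (Nat.pow_pos (Nat.cast_pos.mp hb))
      (fun j k => by positivity) hpt).trans ?_
    have h1 := hsumexp θ (abs_of_pos hθ0)
    have h2 := hsumexp (-θ) (by rw [abs_neg, abs_of_pos hθ0])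
    simp only [F, ← Finset.mul_sum, Finset.sum_add_distrib]
    have hM : (0 : ℝ) < ((b ^ m : ℕ) : ℝ) := by rw [Nat.cast_pow]; positivity
    rw [div_le_iff₀ (by positivity)]
    calc _ ≤ s⁻¹ ^ p * (K * Real.exp 2 * ((b : ℝ) ^ (2 * m) * Real.exp 1
            + (b : ℝ) ^ (2 * m) * Real.exp 1)) := by gcongr
      _ = _ := by
          rw [show (3 : ℝ) = 2 + 1 by norm_num, Real.exp_add]
          push_cast
          ring
  unfold LpDisc
  calc _ ≤ (s⁻¹ ^ p * (2 * K * Real.exp 3)) ^ (1 / p) :=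
        Real.rpow_le_rpow (integral_nonneg fun t => by positivity) hintegral (by positivity)
    _ = s⁻¹ * (2 * K * Real.exp 3) ^ (1 / p) := by
        rw [Real.mul_rpow (by positivity) (by positivity), ← Real.rpow_mul (by positivity),
          mul_one_div_cancel hp.ne', Real.rpow_one]
    _ = _ := by
        rw [hsinv]
        ring

end Sym

-- STATEMENT 18
theorem stmt18 (b : ℕ) (hb : b.Prime) (p : ℝ) (hp : 1 ≤ p) :
    ∃ C : ℝ, 0 < C ∧ ∀ m n : ℕ, 1 ≤ m → 2 * m < n →
      (∀ k₁ k₂ : ℕ,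
        (∀ t : Fin (m + 2),
          (∑ i ∈ Finset.range n, zdgt b k₁ i * hamRow1 b m (i + 1) t)
            + ∑ i ∈ Finset.range n, zdgt b k₂ i * hamRow2 b m (i + 1) t = 0) →
        ¬(k₁ = 0 ∧ k₂ = 0) → 2 * m + 1 < mu2 b k₁ + mu2 b k₂)
      ∧ LpDisc p (truncHamPts b m n)
          ≤ C * Real.sqrt ((m : ℝ) + 2) / (b : ℝ) ^ (m + 2) := by
  have : NeZero b := ⟨hb.ne_zero⟩
  have hb0 : (0 : ℝ) < b := Nat.cast_pos.mpr hb.pos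
  obtain ⟨K, hK, hKexp⟩ := exists_rpow_le_mul_exp p (by linarith)
  refine ⟨2 * b ^ 2 * (2 * K * Real.exp 3) ^ (1 / p), by positivity, fun m n _ hmn => ⟨?_, ?_⟩⟩
  · exact fun k₁ k₂ hdual hk => two_mul_add_one_lt_mu2_add_mu2 hb.two_le hmn hdual hk
  · exact LpDisc_truncHamPts_le (by linarith) hK hKexp (by omega)

end
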